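/- arXiv:2511.07906 — 2 statements merged into one kernel-verified Lean document; each statement's English description precedes it below -/
import Mathlib

section
/- Let (G,E) be a self-similar action. The following are equivalent: (1) the inverse semigroup S(G,E) is locally contracting; (2) S(G,E) is strongly locally contracting; (3) condition (Con) holds: for every v ∈ E⁰ there exists μ ∈ vE^* such that s(μ) is a base vertex of a G-cycle with an entrance. Moreover, if these equivalent conditions hold, then every G-cycle has an entrance. -/
noncomputable section

attribute [local instance] Classical.propDecidable

/-- Raw algebraic data of an inverse semigroup with zero, together with a domain
predicate singling out its genuine elements (the carrier may contain junk). -/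
structure RawSem (T : Type) where
  mul : T → T → T
  star : T → T
  zero : T
  dom : T → Prop

namespace RawSem

variable {T : Type} (R : RawSem T)

/-- The natural partial order: `t ≤ u` iff `t = u ⬝ t* ⬝ t`. -/
def le (t u : T) : Prop := t = R.mul u (R.mul (R.star t) t)

/-- Nonzero idempotents (belonging to the domain). -/
def NzIdem (e : T) : Prop := R.dom e ∧ R.mul e e = e ∧ e ≠ R.zero

/-- `F` covers the idempotent `e`: every nonzero idempotent below `e` meets some `f ∈ F`. -/
def Covers (F : Set T) (e : T) : Prop :=
  ∀ z, R.NzIdem z → R.le z e → ∃ f ∈ F, R.mul z f ≠ R.zero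

/-- The set `F_t` of nonzero idempotents trivially fixed by `t`, i.e. `≤ t`. -/
def TrivFix (t : T) : Set T := {e | R.NzIdem e ∧ R.le e t}

/-- The idempotent `e` is fixed by `t`:
`(t ⬝ f ⬝ t*) ⬝ f ≠ 0` for every nonzero idempotent `f ≤ e`. -/
def FixedBy (e t : T) : Prop :=
  ∀ f, R.NzIdem f → R.le f e → R.mul (R.mul (R.mul t f) (R.star t)) f ≠ R.zero

/-- The inverse semigroup is closed. -/
def Closed : Prop :=
  ∀ t, R.dom t → ∃ F : Finset T, ↑F ⊆ R.TrivFix t ∧ ∀ e ∈ R.TrivFix t, R.Covers ↑F e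

/-- The inverse semigroup is topologically free. -/
def TopFree : Prop :=
  ∀ t e, R.dom t → R.NzIdem e → R.FixedBy e t → ∃ f ∈ R.TrivFix t, R.mul f e ≠ R.zero

/-- The inverse semigroup is effective. -/
def Effective : Prop :=
  ∀ t e, R.dom t → R.NzIdem e → R.FixedBy e t →
    ∃ F : Finset T, ↑F ⊆ R.TrivFix t ∧ R.Covers (↑F) e

/-- The inverse semigroup is minimal. -/
def Minimal : Prop :=
  ∀ e f, R.NzIdem e → R.NzIdem f → ∃ Ts : Finset T, (∀ t ∈ Ts, R.dom t) ∧
    R.Covers ((fun t => R.mul (R.mul t f) (R.star t)) '' ↑Ts) e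

/-- The inverse semigroup is quasi-fundamental. -/
def QuasiFund : Prop :=
  ∀ s t, R.dom s → R.dom t → s ≠ R.zero → t ≠ R.zero →
    (∀ e, R.NzIdem e → R.mul (R.mul s e) (R.star s) = R.mul (R.mul t e) (R.star t)) →
    ∃ u, R.dom u ∧ u ≠ R.zero ∧ R.le u s ∧ R.le u t

/-- The inverse semigroup is fundamental. -/
def Fund : Prop :=
  ∀ s t, R.dom s → R.dom t →
    (∀ e, R.NzIdem e → R.mul (R.mul s e) (R.star s) = R.mul (R.mul t e) (R.star t)) → s = t

/-- The inverse semigroup is `E*`-unitary. -/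
def EUnitary : Prop := ∀ t e, R.dom t → R.NzIdem e → R.le e t → R.mul t t = t

/-- The inverse semigroup is locally contracting. -/
def LocContr : Prop :=
  ∀ e, R.NzIdem e → ∃ s, R.dom s ∧ ∃ F : Finset T, ∃ f₀ ∈ F,
    (∀ f ∈ F, R.NzIdem f ∧ R.le f (R.mul e (R.mul (R.star s) s))) ∧
    ∀ f ∈ F, R.Covers (↑F) (R.mul (R.mul s f) (R.star s)) ∧
      R.mul f₀ (R.mul (R.mul s f) (R.star s)) = R.zero

/-- The inverse semigroup is strongly locally contracting. -/
def StrLocContr : Prop :=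
  ∀ e, R.NzIdem e → ∃ s f₀ f₁, R.dom s ∧ R.NzIdem f₀ ∧ R.NzIdem f₁ ∧
    R.le f₀ f₁ ∧ R.le f₁ (R.mul e (R.mul (R.star s) s)) ∧
    R.le (R.mul (R.mul s f₁) (R.star s)) f₁ ∧
    R.mul f₀ (R.mul (R.mul s f₁) (R.star s)) = R.zero

end RawSem

/-- A self-similar action `(G, E)` of a discrete groupoid `G` on a directed graph `E`
sharing the vertex/unit set `V`, encoded by total operations together with axioms
that hold on composable inputs.  Arrows `g` have source `gs g` and range `gr g`;
edges `e` have source `es e` and range `er e`; `g · e` (written `act g e`) and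
`g |_e` (written `res g e`) are meaningful when `gs g = er e`. -/
structure SSA where
  V : Type
  G : Type
  E : Type
  gs : G → V
  gr : G → V
  es : E → V
  er : E → V
  one : V → G
  mul : G → G → G
  inv : G → G
  act : G → E → E
  res : G → E → G
  gs_one : ∀ v, gs (one v) = v
  gr_one : ∀ v, gr (one v) = v
  gs_mul : ∀ g h, gs g = gr h → gs (mul g h) = gs h
  gr_mul : ∀ g h, gs g = gr h → gr (mul g h) = gr g
  mul_assoc' : ∀ g h k, gs g = gr h → gs h = gr k → mul (mul g h) k = mul g (mul h k)
  one_mul' : ∀ g, mul (one (gr g)) g = g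
  mul_one' : ∀ g, mul g (one (gs g)) = g
  gs_inv : ∀ g, gs (inv g) = gr g
  gr_inv : ∀ g, gr (inv g) = gs g
  mul_inv' : ∀ g, mul g (inv g) = one (gr g)
  inv_mul' : ∀ g, mul (inv g) g = one (gs g)
  er_act : ∀ g e, gs g = er e → er (act g e) = gr g
  act_one : ∀ e, act (one (er e)) e = e
  act_mul : ∀ g h e, gs g = gr h → gs h = er e → act (mul g h) e = act g (act h e)
  gs_res : ∀ g e, gs g = er e → gs (res g e) = es e
  gr_res : ∀ g e, gs g = er e → gr (res g e) = es (act g e)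
  res_mul : ∀ g h e, gs g = gr h → gs h = er e →
    res (mul g h) e = mul (res g (act h e)) (res h e)

namespace SSA

/-- Finite paths in the graph: `Pth S a b` is the type of paths with range `a`
and source `b`; `cons e p` is the path `e · p`. -/
inductive Pth (S : SSA) : S.V → S.V → Type
  | nil (v : S.V) : Pth S v v
  | cons (e : S.E) {b : S.V} (p : Pth S (S.es e) b) : Pth S (S.er e) b

/-- The path category `E^*`, bundled: a finite path with its range and source. -/
structure Path (S : SSA) where
  rng : S.V
  src : S.V
  pth : S.Pth rng src

/-- Infinite paths: sequences of edges `e₁e₂⋯` with `es eᵢ = er e_{i+1}`. -/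
structure InfPath (S : SSA) where
  seq : ℕ → S.E
  chain : ∀ n, S.es (seq n) = S.er (seq (n + 1))

/-- A twist `σ = (σ_G, σ_⋈)` of the self-similar action, with values in the
unit circle `𝕋 ⊆ ℂ`. -/
structure Twist (S : SSA) where
  σG : S.G → S.G → ℂ
  σB : S.G → S.E → ℂ
  σG_unimod : ∀ g h, S.gs g = S.gr h → ‖σG g h‖ = 1
  σB_unimod : ∀ g e, S.gs g = S.er e → ‖σB g e‖ = 1
  σG_cocycle : ∀ g h k, S.gs g = S.gr h → S.gs h = S.gr k →
    σG g h * σG (S.mul g h) k = σG h k * σG g (S.mul h k)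
  σG_one_left : ∀ g, σG (S.one (S.gr g)) g = 1
  σG_one_right : ∀ g, σG g (S.one (S.gs g)) = 1
  σB_one : ∀ e, σB (S.one (S.er e)) e = 1
  σB_cocycle : ∀ g h e, S.gs g = S.gr h → S.gs h = S.er e →
    σB h e * (starRingEnd ℂ) (σB (S.mul g h) e) * σB g (S.act h e) =
      (starRingEnd ℂ) (σG (S.res g (S.act h e)) (S.res h e)) * σG g h

variable {S : SSA}

namespace Pth

def length : ∀ {a b : S.V}, S.Pth a b → ℕ
  | _, _, .nil _ => 0
  | _, _, .cons _ p => length p + 1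

def toList : ∀ {a b : S.V}, S.Pth a b → List S.E
  | _, _, .nil _ => []
  | _, _, .cons e p => e :: toList p

def comp : ∀ {a b c : S.V}, S.Pth a b → S.Pth b c → S.Pth a c
  | _, _, _, .nil _, q => q
  | _, _, _, .cons e p, q => .cons e (comp p q)

end Pth

def Path.length (p : Path S) : ℕ := p.pth.length

def Path.toList (p : Path S) : List S.E := p.pth.toList

/-- A vertex regarded as a path of length `0`. -/
def Path.vert (S : SSA) (v : S.V) : Path S := ⟨v, v, .nil v⟩

/-- An edge regarded as a path of length `1`. -/
def Path.ofEdge (S : SSA) (e : S.E) : Path S := ⟨S.er e, S.es e, .cons e (.nil (S.es e))⟩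

/-- Concatenation of paths (junk -- the first path -- when not composable). -/
def Path.comp (p q : Path S) : Path S :=
  if h : p.src = q.rng then
    ⟨p.rng, q.src, Pth.comp (cast (congrArg (S.Pth p.rng) h) p.pth) q.pth⟩
  else p

/-- `q` is a prefix of `p`, i.e. `p` extends `q`. -/
def IsPrefix (S : SSA) (q p : Path S) : Prop :=
  ∃ r : Path S, q.src = r.rng ∧ p = q.comp r

/-- Two paths are comparable if one is a prefix of the other. -/
def Comparable (S : SSA) (p q : Path S) : Prop := IsPrefix S p q ∨ IsPrefix S q p

/-- The extended left action of groupoid arrows on finite paths,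
given by the recursive recipe `g · v = r g`, `g · (e μ) = (g · e) (g|_e · μ)`. -/
def pactAux (S : SSA) : ∀ {a b : S.V}, S.G → S.Pth a b → Path S
  | _, _, g, .nil _ => Path.vert S (S.gr g)
  | _, _, g, .cons e p => (Path.ofEdge S (S.act g e)).comp (pactAux S (S.res g e) p)

/-- The extended left action `g · μ` on finite paths. -/
def pact (S : SSA) (g : S.G) (p : Path S) : Path S := pactAux S g p.pth

/-- The extended restriction map, given by `g|_v = g` and `g|_{e μ} = (g|_e)|_μ`. -/
def presAux (S : SSA) : ∀ {a b : S.V}, S.G → S.Pth a b → S.G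
  | _, _, g, .nil _ => g
  | _, _, g, .cons e p => presAux S (S.res g e) p

/-- The extended restriction map `g |_μ` on finite paths. -/
def pres (S : SSA) (g : S.G) (p : Path S) : S.G := presAux S g p.pth

/-- `g` strongly fixes the path `p` : `g · p = p` and `g|_p = s p`. -/
def SFix (S : SSA) (g : S.G) (p : Path S) : Prop :=
  S.gs g = p.rng ∧ pact S g p = p ∧ pres S g p = S.one p.src

/-- `p` is a minimal strongly `g`-fixed path. -/
def MinSFix (S : SSA) (g : S.G) (p : Path S) : Prop :=
  SFix S g p ∧ ∀ q : Path S, IsPrefix S q p → q ≠ p → ¬ SFix S g q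

/-- `g` is a unit of the groupoid (an element of `G⁰`). -/
def IsUnitArrow (S : SSA) (g : S.G) : Prop := g = S.one (S.gs g)

/-- `g` fixes every path in `s(g)E^*`. -/
def FixesAll (S : SSA) (g : S.G) : Prop :=
  ∀ p : Path S, p.rng = S.gs g → pact S g p = p

/-- Condition (Fin): every `g` admits at most finitely many minimal strongly
`g`-fixed paths. -/
def CondFin (S : SSA) : Prop := ∀ g : S.G, {p : Path S | MinSFix S g p}.Finite

/-- Condition (Evr): if `g` fixes every path in `s(g)E^*` then `g` strongly fixes
some path in `s(g)E^*`. -/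
def CondEvr (S : SSA) : Prop := ∀ g : S.G, FixesAll S g → ∃ p : Path S, SFix S g p

/-- `p` is a `g`-cycle: a path of positive length with `g · s(p) = r(p)`. -/
def GCycle (S : SSA) (g : S.G) (p : Path S) : Prop :=
  1 ≤ p.length ∧ S.gs g = p.src ∧ S.gr g = p.rng

/-- The vertex `v` receives at least two distinct edges. -/
def HasEntranceVert (S : SSA) (v : S.V) : Prop :=
  ∃ e f : S.E, e ≠ f ∧ S.er e = v ∧ S.er f = v

/-- Base vertices of a finite path. -/
def Path.baseVerts (p : Path S) : Set S.V :=
  insert p.rng {v : S.V | ∃ e ∈ p.toList, S.es e = v}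

/-- A finite path has an entrance. -/
def Path.hasEntrance (p : Path S) : Prop := ∃ v ∈ p.baseVerts, HasEntranceVert S v

/-- Condition (Cyc): every `G`-cycle has an entrance. -/
def CondCyc (S : SSA) : Prop := ∀ (g : S.G) (p : Path S), GCycle S g p → p.hasEntrance

/-- `g` has slack. -/
def HasSlack (S : SSA) (g : S.G) : Prop :=
  ∃ F : Finset (Path S), (∀ p ∈ F, SFix S g p) ∧
    ∀ q : Path S, q.rng = S.gs g → ∃ p ∈ F, Comparable S p q

/-- Condition (Sla): if `g` fixes every path in `s(g)E^*` then `g` has slack. -/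
def CondSla (S : SSA) : Prop := ∀ g : S.G, FixesAll S g → HasSlack S g

def InfPath.rng (ξ : InfPath S) : S.V := S.er (ξ.seq 0)

/-- Base vertices of an infinite path. -/
def InfPath.baseVerts (ξ : InfPath S) : Set S.V := {v : S.V | ∃ n, S.er (ξ.seq n) = v}

/-- An infinite path has an entrance. -/
def InfPath.hasEntrance (ξ : InfPath S) : Prop := ∃ v ∈ ξ.baseVerts, HasEntranceVert S v

/-- The finite path `p` is a prefix of the infinite path `ξ`. -/
def PrefixOfInf (S : SSA) (p : Path S) (ξ : InfPath S) : Prop :=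
  p.rng = ξ.rng ∧ ∀ i : ℕ, i < p.length → p.toList[i]? = some (ξ.seq i)

/-- Finite or infinite paths. -/
abbrev GenPath (S : SSA) : Type := Path S ⊕ InfPath S

/-- The finite path `p` is a prefix of the finite or infinite path `ξ`. -/
def GPrefix (S : SSA) (p : Path S) : GenPath S → Prop
  | .inl q => IsPrefix S p q
  | .inr ξ => PrefixOfInf S p ξ

/-- The set `vE¹` of edges received by the vertex `v`. -/
def recvSet (S : SSA) (v : S.V) : Set S.E := {e : S.E | S.er e = v}

/-- A vertex is singular if it is a source or an infinite receiver. -/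
def Singular (S : SSA) (v : S.V) : Prop := recvSet S v = ∅ ∨ (recvSet S v).Infinite

/-- A vertex is regular if it is not singular. -/
def Regular (S : SSA) (v : S.V) : Prop := ¬ Singular S v

/-- The preorder `v ≪ w`: there is `v'` with `vE^*v' ≠ ∅` and `v'Gw ≠ ∅`. -/
def ll (S : SSA) (v w : S.V) : Prop :=
  ∃ (p : Path S) (g : S.G), p.rng = v ∧ S.gr g = p.src ∧ S.gs g = w

/-- Cofinality of the self-similar action: for every boundary path (a finite path
with singular source, or an infinite path) and every vertex `v`, some base vertex
`w` of the path satisfies `v ≪ w`. -/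
def Cofinal (S : SSA) : Prop :=
  (∀ p : Path S, Singular S p.src → ∀ v : S.V, ∃ w ∈ p.baseVerts, ll S v w) ∧
  (∀ ξ : InfPath S, ∀ v : S.V, ∃ w ∈ ξ.baseVerts, ll S v w)

def Hereditary (S : SSA) (W : Set S.V) : Prop :=
  ∀ v ∈ W, ∀ p : Path S, p.rng = v → p.src ∈ W

def Saturated (S : SSA) (W : Set S.V) : Prop :=
  ∀ w : S.V, Regular S w → (∀ e : S.E, S.er e = w → S.es e ∈ W) → w ∈ W

def GInvariant (S : SSA) (W : Set S.V) : Prop := ∀ g : S.G, S.gs g ∈ W → S.gr g ∈ W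

/-- `(G,E)`-invariant subsets of `E⁰`: `G`-invariant, hereditary and saturated. -/
def SSAInvariant (S : SSA) (W : Set S.V) : Prop :=
  GInvariant S W ∧ Hereditary S W ∧ Saturated S W

/-- Condition (Con): every vertex is reachable from a `G`-cycle with an entrance. -/
def CondCon (S : SSA) : Prop :=
  ∀ v : S.V, ∃ p : Path S, p.rng = v ∧
    ∃ (g : S.G) (c : Path S), GCycle S g c ∧ c.hasEntrance ∧ p.src ∈ c.baseVerts

/-- The underlying set (with zero `none`) of the inverse semigroup `S(G,E)`. -/
abbrev SGE (S : SSA) : Type := Option (Path S × S.G × Path S)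

/-- Well-formedness of a triple `(α, g, β)` : `r g = s α` and `s g = s β`. -/
def SGE.wf (S : SSA) : SGE S → Prop
  | none => True
  | some (α, g, β) => S.gr g = α.src ∧ S.gs g = β.src

/-- The idempotent `f_α = (α, s α, α)`. -/
def fIdem (S : SSA) (α : Path S) : SGE S := some (α, S.one α.src, α)

/-- The involution `(α,g,β)* = (β,g⁻¹,α)` on `S(G,E)`. -/
def sgeStar (S : SSA) : SGE S → SGE S
  | none => none
  | some (α, g, β) => some (β, S.inv g, α)

/-- The multiplication of the inverse semigroup `S(G,E)`. -/
def sgeMul (S : SSA) : SGE S → SGE S → SGE S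
  | none, _ => none
  | some _, none => none
  | some (α, g, β), some (γ, h, δ) =>
    if SGE.wf S (some (α, g, β)) ∧ SGE.wf S (some (γ, h, δ)) then
      if h1 : ∃ β' : Path S, β.src = Path.rng β' ∧ γ = β.comp β' then
        some (α.comp (pact S g h1.choose), S.mul (pres S g h1.choose) h, δ)
      else if h2 : ∃ γ' : Path S, γ.src = Path.rng γ' ∧ β = γ.comp γ' then
        some (α, S.mul g (S.inv (pres S (S.inv h) h2.choose)),
          δ.comp (pact S (S.inv h) h2.choose))
      else none
    else none

/-- Membership in the subsemigroup `S₀(G,E)` (with zero): triples with `|α| = |β|`. -/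
def domS0 (S : SSA) (x : SGE S) : Prop :=
  SGE.wf S x ∧ (x = none ∨ ∃ (α : Path S) (g : S.G) (β : Path S),
    x = some (α, g, β) ∧ α.length = β.length)

/-- Membership in the subsemigroup `S₀₀(G,E)` (with zero): triples `(g·β, g|_β, β)`. -/
def domS00 (S : SSA) (x : SGE S) : Prop :=
  SGE.wf S x ∧ (x = none ∨ ∃ (g : S.G) (β : Path S),
    S.gs g = β.rng ∧ x = some (pact S g β, pres S g β, β))

/-- `S(G,E)` as raw inverse-semigroup data. -/
def sgeSem (S : SSA) : RawSem (SGE S) := ⟨sgeMul S, sgeStar S, none, SGE.wf S⟩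

/-- `S₀(G,E)` as raw inverse-semigroup data. -/
def sgeSem0 (S : SSA) : RawSem (SGE S) := ⟨sgeMul S, sgeStar S, none, domS0 S⟩

/-- `S₀₀(G,E)` as raw inverse-semigroup data. -/
def sgeSem00 (S : SSA) : RawSem (SGE S) := ⟨sgeMul S, sgeStar S, none, domS00 S⟩

/-- The inductive extension of `σ_⋈` to finite paths:
`σ_⋈(h, s h) = 1`, `σ_⋈(h, e μ) = σ_⋈(h, e) σ_⋈(h|_e, μ)`. -/
def twAux (S : SSA) (σB : S.G → S.E → ℂ) : ∀ {a b : S.V}, S.G → S.Pth a b → ℂ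
  | _, _, _, .nil _ => 1
  | _, _, g, .cons e p => σB g e * twAux S σB (S.res g e) p

/-- The extension `σ_⋈ : G * E^* → 𝕋` of a twist to finite paths. -/
def twP (S : SSA) (σB : S.G → S.E → ℂ) (g : S.G) (p : Path S) : ℂ := twAux S σB g p.pth

/-- The `2`-cocycle `ω_σ` on `S(G,E)` induced by a twist `σ` of `(G,E)`. -/
def omg (S : SSA) (T : Twist S) : SGE S → SGE S → ℂ := fun x y =>
  match x, y with
  | some (_, g, β), some (γ, h, _) =>
    if h1 : ∃ β' : Path S, β.src = Path.rng β' ∧ γ = β.comp β' then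
      twP S T.σB g h1.choose * T.σG (pres S g h1.choose) h
    else if h2 : ∃ γ' : Path S, γ.src = Path.rng γ' ∧ β = γ.comp γ' then
      T.σG g (S.inv (pres S (S.inv h) h2.choose)) * twP S T.σB h (pact S (S.inv h) h2.choose)
    else 1
  | _, _ => 1

end SSA

namespace SSA

variable {S : SSA}

/-! ### Groupoid basics -/

theorem inv_unique (g h : S.G) (h1 : S.gs g = S.gr h) (h2 : S.mul g h = S.one (S.gr g)) :
    h = S.inv g := by
  have hg : S.gs h = S.gr g := by
    have := S.gs_mul g h h1
    rw [h2, S.gs_one] at this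
    exact this.symm
  calc h = S.mul (S.one (S.gr h)) h := (S.one_mul' h).symm
    _ = S.mul (S.mul (S.inv g) g) h := by rw [S.inv_mul', h1]
    _ = S.mul (S.inv g) (S.mul g h) := S.mul_assoc' _ _ _ (S.gs_inv g) h1
    _ = S.mul (S.inv g) (S.one (S.gs (S.inv g))) := by rw [h2, S.gs_inv]
    _ = S.inv g := S.mul_one' _

theorem inv_inv' (g : S.G) : S.inv (S.inv g) = g := by
  symm
  apply inv_unique
  · exact S.gs_inv g
  · rw [S.inv_mul', S.gr_inv]

theorem one_mul_one (v : S.V) : S.mul (S.one v) (S.one v) = S.one v := by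
  have := S.one_mul' (S.one v)
  rwa [S.gr_one] at this

theorem inv_one' (v : S.V) : S.inv (S.one v) = S.one v := by
  symm
  apply inv_unique
  · rw [S.gs_one, S.gr_one]
  · rw [one_mul_one, S.gr_one]

theorem idem_one (g : S.G) (h : S.gs g = S.gr g) (hg : S.mul g g = g) : g = S.one (S.gs g) := by
  calc g = S.mul (S.one (S.gr g)) g := (S.one_mul' g).symm
    _ = S.mul (S.mul (S.inv g) g) g := by rw [S.inv_mul', h]
    _ = S.mul (S.inv g) (S.mul g g) := S.mul_assoc' _ _ _ (S.gs_inv g) h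
    _ = S.mul (S.inv g) g := by rw [hg]
    _ = _ := S.inv_mul' g

theorem act_one' (v : S.V) (e : S.E) (h : S.er e = v) : S.act (S.one v) e = e := by
  subst h; exact S.act_one e

theorem res_one' (v : S.V) (e : S.E) (h : S.er e = v) : S.res (S.one v) e = S.one (S.es e) := by
  subst h
  have hs : S.gs (S.one (S.er e)) = S.er e := S.gs_one _
  have h1 := S.gs_res _ e hs
  have h2 := S.gr_res _ e hs
  rw [S.act_one] at h2
  have h3 := S.res_mul (S.one (S.er e)) (S.one (S.er e)) e (by rw [S.gs_one, S.gr_one]) hs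
  rw [one_mul_one, S.act_one] at h3
  have := idem_one _ (h1.trans h2.symm) h3.symm
  rw [this, h1]

theorem act_inv_act (g : S.G) (e : S.E) (h : S.gs g = S.er e) :
    S.act (S.inv g) (S.act g e) = e := by
  rw [← S.act_mul _ _ _ (S.gs_inv g) h, S.inv_mul', act_one' _ _ h.symm]

theorem res_inv_act (g : S.G) (e : S.E) (h : S.gs g = S.er e) :
    S.res (S.inv g) (S.act g e) = S.inv (S.res g e) := by
  have hi : S.gs (S.inv g) = S.er (S.act g e) := by rw [S.gs_inv, S.er_act _ _ h]
  have h1 := S.res_mul (S.inv g) g e (S.gs_inv g) h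
  rw [S.inv_mul', res_one' _ _ h.symm] at h1
  have hc : S.gs (S.res (S.inv g) (S.act g e)) = S.gr (S.res g e) := by
    rw [S.gs_res _ _ hi, S.gr_res _ _ h]
  have h2 := inv_unique (S.res (S.inv g) (S.act g e)) (S.res g e) hc
    (by rw [← h1, S.gr_res _ _ hi, act_inv_act _ _ h])
  rw [h2, inv_inv']

/-! ### Action on lists of edges -/

def vld (S : SSA) : S.V → List S.E → Prop
  | _, [] => True
  | v, e :: l => S.er e = v ∧ vld S (S.es e) l

def actL (S : SSA) : S.G → List S.E → List S.E
  | _, [] => []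
  | g, e :: l => S.act g e :: actL S (S.res g e) l

def resL (S : SSA) : S.G → List S.E → S.G
  | g, [] => g
  | g, e :: l => resL S (S.res g e) l

def endV (S : SSA) : S.V → List S.E → S.V
  | v, [] => v
  | _, e :: l => endV S (S.es e) l

theorem length_actL (g : S.G) (l : List S.E) : (actL S g l).length = l.length := by
  induction l generalizing g with
  | nil => rfl
  | cons e l ih => simp [actL, ih]

theorem vld_append (v : S.V) (l m : List S.E) :
    vld S v (l ++ m) ↔ vld S v l ∧ vld S (endV S v l) m := by
  induction l generalizing v with
  | nil => simp [vld, endV]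
  | cons e l ih => simp [vld, endV, ih, and_assoc]

theorem vld_prefix {v : S.V} {l m : List S.E} (h : l <+: m) (hm : vld S v m) : vld S v l := by
  obtain ⟨t, rfl⟩ := h
  exact ((vld_append _ _ _).1 hm).1

theorem actL_append (g : S.G) (l m : List S.E) :
    actL S g (l ++ m) = actL S g l ++ actL S (resL S g l) m := by
  induction l generalizing g with
  | nil => rfl
  | cons e l ih => simp [actL, resL, ih]

theorem actL_prefix (g : S.G) {l m : List S.E} (h : l <+: m) : actL S g l <+: actL S g m := by
  obtain ⟨t, rfl⟩ := h
  rw [actL_append]; exact List.prefix_append _ _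

theorem actL_vld (g : S.G) (l : List S.E) (h : vld S (S.gs g) l) : vld S (S.gr g) (actL S g l) := by
  induction l generalizing g with
  | nil => trivial
  | cons e l ih =>
    obtain ⟨h1, h2⟩ := h
    refine ⟨S.er_act _ _ h1.symm, ?_⟩
    rw [← S.gr_res _ _ h1.symm]
    apply ih
    rwa [S.gs_res _ _ h1.symm]

theorem actL_one (v : S.V) (l : List S.E) (h : vld S v l) : actL S (S.one v) l = l := by
  induction l generalizing v with
  | nil => rfl
  | cons e l ih =>
    obtain ⟨h1, h2⟩ := h
    simp [actL, act_one' _ _ h1, res_one' _ _ h1, ih _ h2]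

theorem resL_one (v : S.V) (l : List S.E) (h : vld S v l) :
    resL S (S.one v) l = S.one (endV S v l) := by
  induction l generalizing v with
  | nil => rfl
  | cons e l ih =>
    obtain ⟨h1, h2⟩ := h
    simp [resL, endV, res_one' _ _ h1, ih _ h2]

theorem actL_inv (g : S.G) (l : List S.E) (h : vld S (S.gs g) l) :
    actL S (S.inv g) (actL S g l) = l := by
  induction l generalizing g with
  | nil => rfl
  | cons e l ih =>
    obtain ⟨h1, h2⟩ := h
    simp only [actL]
    rw [act_inv_act _ _ h1.symm, res_inv_act _ _ h1.symm, ih]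
    rwa [S.gs_res _ _ h1.symm]

theorem actL_inv' (g : S.G) (l : List S.E) (h : vld S (S.gr g) l) :
    actL S g (actL S (S.inv g) l) = l := by
  have := actL_inv (S.inv g) l (by rwa [S.gs_inv])
  rwa [inv_inv'] at this

theorem gs_resL (g : S.G) (l : List S.E) (h : vld S (S.gs g) l) :
    S.gs (resL S g l) = endV S (S.gs g) l := by
  induction l generalizing g with
  | nil => rfl
  | cons e l ih =>
    obtain ⟨h1, h2⟩ := h
    simp only [resL, endV]
    rw [← S.gs_res _ _ h1.symm] at h2
    rw [ih _ h2, S.gs_res _ _ h1.symm]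

theorem gr_resL (g : S.G) (l : List S.E) (h : vld S (S.gs g) l) :
    S.gr (resL S g l) = endV S (S.gr g) (actL S g l) := by
  induction l generalizing g with
  | nil => rfl
  | cons e l ih =>
    obtain ⟨h1, h2⟩ := h
    simp only [resL, actL, endV]
    rw [← S.gs_res _ _ h1.symm] at h2
    rw [ih _ h2, S.gr_res _ _ h1.symm]

/-! ### Paths versus lists -/

theorem toList_pcomp : ∀ {a b c : S.V} (p : S.Pth a b) (q : S.Pth b c),
    (p.comp q).toList = p.toList ++ q.toList
  | _, _, _, .nil _, q => rfl
  | _, _, _, .cons e p, q => by simp [Pth.comp, Pth.toList, toList_pcomp p q]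

theorem length_pth : ∀ {a b : S.V} (p : S.Pth a b), p.length = p.toList.length
  | _, _, .nil _ => rfl
  | _, _, .cons e p => by simp [Pth.length, Pth.toList, length_pth p]

theorem Path.length_eq (p : Path S) : p.length = p.toList.length := length_pth _

theorem vld_pth : ∀ {a b : S.V} (p : S.Pth a b), vld S a p.toList
  | _, _, .nil _ => trivial
  | _, _, .cons e p => ⟨rfl, vld_pth p⟩

theorem endV_pth : ∀ {a b : S.V} (p : S.Pth a b), endV S a p.toList = b
  | _, _, .nil _ => rfl
  | _, _, .cons e p => endV_pth p

theorem Path.vld (p : Path S) : SSA.vld S p.rng p.toList := vld_pth _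

theorem Path.src_eq (p : Path S) : p.src = endV S p.rng p.toList := (endV_pth _).symm

theorem path_ext_aux {a b : S.V} (p : S.Pth a b) : ∀ {a' b' : S.V} (q : S.Pth a' b'),
    a = a' → p.toList = q.toList → (⟨a, b, p⟩ : Path S) = ⟨a', b', q⟩ := by
  induction p with
  | nil v =>
    intro a' b' q h hl
    cases q with
    | nil => subst h; rfl
    | cons e q => simp [Pth.toList] at hl
  | cons e p ih =>
    intro a' b' q h hl
    cases q with
    | nil => simp [Pth.toList] at hl
    | cons e' q =>
      simp only [Pth.toList, List.cons.injEq] at hl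
      obtain ⟨rfl, hl⟩ := hl
      have := ih q rfl hl
      simp only [Path.mk.injEq, true_and] at this
      obtain ⟨rfl, h2⟩ := this
      rw [eq_of_heq h2]

theorem Path.ext' {p q : Path S} (h : p.rng = q.rng) (hl : p.toList = q.toList) : p = q := by
  obtain ⟨a, b, p⟩ := p
  obtain ⟨a', b', q⟩ := q
  exact path_ext_aux p q h hl

theorem comp_rng (p q : Path S) : (p.comp q).rng = p.rng := by
  unfold Path.comp; split <;> rfl

theorem comp_src {p q : Path S} (h : p.src = q.rng) : (p.comp q).src = q.src := by
  unfold Path.comp; rw [dif_pos h]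

theorem comp_toList {p q : Path S} (h : p.src = q.rng) :
    (p.comp q).toList = p.toList ++ q.toList := by
  obtain ⟨a, b, p⟩ := p
  obtain ⟨a', b', q⟩ := q
  dsimp at h
  subst h
  unfold Path.comp
  rw [dif_pos rfl]
  exact toList_pcomp _ _

theorem exists_path (v : S.V) (l : List S.E) (h : vld S v l) :
    ∃ p : Path S, p.rng = v ∧ p.toList = l := by
  induction l generalizing v with
  | nil => exact ⟨Path.vert S v, rfl, rfl⟩
  | cons e l ih =>
    obtain ⟨rfl, h2⟩ := h
    obtain ⟨⟨a, b, p⟩, h3, h4⟩ := ih _ h2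
    dsimp at h3
    subst h3
    exact ⟨⟨_, _, .cons e p⟩, rfl, by simpa [Path.toList, Pth.toList] using h4⟩

theorem pact_aux : ∀ {a b : S.V} (p : S.Pth a b) (g : S.G), S.gs g = a →
    (pactAux S g p).rng = S.gr g ∧ (pactAux S g p).toList = actL S g p.toList
  | _, _, .nil _, g, h => ⟨rfl, rfl⟩
  | _, _, .cons e p, g, h => by
    obtain ⟨h1, h2⟩ := pact_aux p (S.res g e) (S.gs_res _ _ h)
    have hc : (Path.ofEdge S (S.act g e)).src = (pactAux S (S.res g e) p).rng := by
      rw [h1, S.gr_res _ _ h]; rfl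
    constructor
    · rw [pactAux, comp_rng]; exact S.er_act _ _ h
    · rw [pactAux, comp_toList hc, h2]; rfl

theorem pact_rng {g : S.G} {p : Path S} (h : S.gs g = p.rng) : (pact S g p).rng = S.gr g :=
  (pact_aux _ _ h).1

theorem pact_toList {g : S.G} {p : Path S} (h : S.gs g = p.rng) :
    (pact S g p).toList = actL S g p.toList := (pact_aux _ _ h).2

theorem pres_aux : ∀ {a b : S.V} (p : S.Pth a b) (g : S.G), presAux S g p = resL S g p.toList
  | _, _, .nil _, _ => rfl
  | _, _, .cons e p, g => pres_aux p (S.res g e)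

theorem pres_eq (g : S.G) (p : Path S) : pres S g p = resL S g p.toList := pres_aux _ _

theorem pact_src {g : S.G} {p : Path S} (h : S.gs g = p.rng) :
    (pact S g p).src = S.gr (pres S g p) := by
  rw [Path.src_eq, pact_rng h, pact_toList h, pres_eq, gr_resL]
  rw [h]; exact p.vld

theorem pres_gs {g : S.G} {p : Path S} (h : S.gs g = p.rng) :
    S.gs (pres S g p) = p.src := by
  rw [pres_eq, gs_resL _ _ (by rw [h]; exact p.vld), h, ← Path.src_eq]

theorem pact_one {v : S.V} {p : Path S} (h : v = p.rng) : pact S (S.one v) p = p := by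
  have h' : S.gs (S.one v) = p.rng := by rw [S.gs_one, h]
  apply Path.ext'
  · rw [pact_rng h', S.gr_one, h]
  · rw [pact_toList h', actL_one]; rw [h]; exact p.vld

theorem pres_one {v : S.V} {p : Path S} (h : v = p.rng) :
    pres S (S.one v) p = S.one p.src := by
  rw [pres_eq, resL_one _ _ (by rw [h]; exact p.vld), h, ← Path.src_eq]

theorem isPrefix_iff (q p : Path S) :
    IsPrefix S q p ↔ q.rng = p.rng ∧ q.toList <+: p.toList := by
  constructor
  · rintro ⟨r, h, rfl⟩
    exact ⟨(comp_rng _ _).symm, by rw [comp_toList h]; exact List.prefix_append _ _⟩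
  · rintro ⟨h, t, ht⟩
    have hv := p.vld
    rw [← ht, vld_append, ← h, ← Path.src_eq] at hv
    obtain ⟨r, hr, hr'⟩ := exists_path _ _ hv.2
    refine ⟨r, hr.symm, Path.ext' ?_ ?_⟩
    · rw [comp_rng, h]
    · rw [comp_toList hr.symm, hr', ht]

theorem comp_cancel {p q r : Path S} (hq : p.src = q.rng) (hr : p.src = r.rng)
    (h : p.comp q = p.comp r) : q = r := by
  apply Path.ext' (hq.symm.trans hr)
  have := congrArg Path.toList h
  rw [comp_toList hq, comp_toList hr] at this
  exact List.append_cancel_left this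

theorem comp_vert (p : Path S) (v : S.V) (h : p.src = v) : p.comp (Path.vert S v) = p := by
  have h' : p.src = (Path.vert S v).rng := h
  apply Path.ext' (comp_rng _ _)
  rw [comp_toList h']
  exact List.append_nil _

end SSA

namespace SSA

variable {S : SSA}

/-! ### The inverse semigroup -/

theorem sem_mul : (sgeSem S).mul = sgeMul S := rfl

theorem sem_star : (sgeSem S).star = sgeStar S := rfl

theorem sem_zero : (sgeSem S).zero = none := rfl

theorem sem_dom : (sgeSem S).dom = SGE.wf S := rfl

theorem sgeMul_left {α β β' δ : Path S} {g h : S.G}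
    (w1 : SGE.wf S (some (α, g, β))) (w2 : SGE.wf S (some (β.comp β', h, δ)))
    (hb : β.src = β'.rng) :
    sgeMul S (some (α, g, β)) (some (β.comp β', h, δ)) =
      some (α.comp (pact S g β'), S.mul (pres S g β') h, δ) := by
  have h1 : ∃ b : Path S, β.src = Path.rng b ∧ β.comp β' = β.comp b := ⟨β', hb, rfl⟩
  have hc : h1.choose = β' := (comp_cancel hb h1.choose_spec.1 h1.choose_spec.2).symm
  simp only [sgeMul]
  rw [if_pos ⟨w1, w2⟩, dif_pos h1, hc]

theorem sgeMul_left' {α β γ δ : Path S} {g h : S.G}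
    (w1 : SGE.wf S (some (α, g, β))) (w2 : SGE.wf S (some (γ, h, δ)))
    (hb : β = γ) :
    sgeMul S (some (α, g, β)) (some (γ, h, δ)) = some (α, S.mul g h, δ) := by
  subst hb
  have hg : S.gr g = α.src := w1.1
  have := sgeMul_left (β' := Path.vert S β.src) w1 (by rwa [comp_vert _ _ rfl]) rfl
  rw [comp_vert _ _ rfl] at this
  rw [this]
  congr 2
  exact comp_vert _ _ hg.symm

theorem sgeMul_right {α γ γ' δ : Path S} {g h : S.G}
    (w1 : SGE.wf S (some (α, g, γ.comp γ'))) (w2 : SGE.wf S (some (γ, h, δ)))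
    (hb : γ.src = γ'.rng) :
    sgeMul S (some (α, g, γ.comp γ')) (some (γ, h, δ)) =
      some (α, S.mul g (S.inv (pres S (S.inv h) γ')), δ.comp (pact S (S.inv h) γ')) := by
  by_cases hl : γ'.toList = []
  · have hv : γ' = Path.vert S γ.src := Path.ext' hb.symm hl
    subst hv
    rw [sgeMul_left' w1 w2 (comp_vert _ _ rfl)]
    have e1 : pres S (S.inv h) (Path.vert S γ.src) = S.inv h := rfl
    have e2 : pact S (S.inv h) (Path.vert S γ.src) = Path.vert S (S.gr (S.inv h)) := rfl
    rw [e1, e2, inv_inv', comp_vert]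
    rw [S.gr_inv]; exact w2.2.symm
  · have h2 : ∃ b : Path S, γ.src = Path.rng b ∧ γ.comp γ' = γ.comp b := ⟨γ', hb, rfl⟩
    have hc : h2.choose = γ' := (comp_cancel hb h2.choose_spec.1 h2.choose_spec.2).symm
    have h1 : ¬ ∃ b : Path S, (γ.comp γ').src = Path.rng b ∧ γ = (γ.comp γ').comp b := by
      rintro ⟨b, hb1, hb2⟩
      have := congrArg (fun p => p.toList.length) hb2
      simp only [comp_toList hb1, comp_toList hb, List.length_append] at this
      exact hl (List.length_eq_zero_iff.1 (by omega))
    simp only [sgeMul]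
    rw [if_pos ⟨w1, w2⟩, dif_neg h1, dif_pos h2, hc]

theorem sgeMul_none {α β γ δ : Path S} {g h : S.G}
    (h1 : ¬ IsPrefix S β γ) (h2 : ¬ IsPrefix S γ β) :
    sgeMul S (some (α, g, β)) (some (γ, h, δ)) = none := by
  simp only [sgeMul]
  unfold IsPrefix at h1 h2
  split <;> simp_all

theorem wf_fIdem (α : Path S) : SGE.wf S (fIdem S α) := ⟨S.gr_one _, S.gs_one _⟩

theorem star_fIdem (α : Path S) : sgeStar S (fIdem S α) = fIdem S α := by
  simp [sgeStar, fIdem, inv_one']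

theorem fIdem_inj {α β : Path S} (h : fIdem S α = fIdem S β) : α = β := by
  simp only [fIdem, Option.some.injEq, Prod.mk.injEq] at h
  exact h.1

theorem mul_fIdem_left {α β : Path S} (h : IsPrefix S α β) :
    sgeMul S (fIdem S α) (fIdem S β) = fIdem S β := by
  obtain ⟨b, hb, rfl⟩ := h
  rw [fIdem, fIdem, sgeMul_left (wf_fIdem α) (wf_fIdem _) hb, pact_one hb, pres_one hb,
    comp_src hb, one_mul_one]

theorem mul_fIdem_right {α β : Path S} (h : IsPrefix S β α) :
    sgeMul S (fIdem S α) (fIdem S β) = fIdem S α := by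
  obtain ⟨b, hb, rfl⟩ := h
  rw [fIdem, fIdem, sgeMul_right (wf_fIdem _) (wf_fIdem _) hb, inv_one', pact_one hb, pres_one hb,
    comp_src hb, inv_one', one_mul_one]

theorem mul_fIdem_none {α β : Path S} (h : ¬ Comparable S α β) :
    sgeMul S (fIdem S α) (fIdem S β) = none :=
  sgeMul_none (fun h1 => h (Or.inl h1)) (fun h1 => h (Or.inr h1))

theorem mul_fIdem_eq_none (α β : Path S) :
    sgeMul S (fIdem S α) (fIdem S β) = none ↔ ¬ Comparable S α β := by
  constructor
  · rintro h (h1 | h1)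
    · rw [mul_fIdem_left h1] at h; simp [fIdem] at h
    · rw [mul_fIdem_right h1] at h; simp [fIdem] at h
  · exact mul_fIdem_none

theorem isPrefix_refl (p : Path S) : IsPrefix S p p :=
  (isPrefix_iff _ _).2 ⟨rfl, List.prefix_refl _⟩

theorem isPrefix_trans {p q r : Path S} (h1 : IsPrefix S p q) (h2 : IsPrefix S q r) :
    IsPrefix S p r := by
  rw [isPrefix_iff] at *
  exact ⟨h1.1.trans h2.1, h1.2.trans h2.2⟩

theorem isPrefix_antisymm {p q : Path S} (h1 : IsPrefix S p q) (h2 : IsPrefix S q p) :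
    p = q := by
  rw [isPrefix_iff] at *
  exact Path.ext' h1.1 (h1.2.eq_of_length_le h2.2.length_le)

theorem isPrefix_comp {p q : Path S} (h : p.src = q.rng) : IsPrefix S p (p.comp q) := ⟨q, h, rfl⟩

theorem nzIdem_fIdem (α : Path S) : (sgeSem S).NzIdem (fIdem S α) :=
  ⟨wf_fIdem α, mul_fIdem_left (isPrefix_refl α), by simp [fIdem, sgeSem]⟩

theorem nzIdem_elim {e : SGE S} (h : (sgeSem S).NzIdem e) : ∃ α, e = fIdem S α := by
  obtain ⟨h1, h2, h3⟩ := h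
  rcases e with _ | ⟨α, g, β⟩
  · exact absurd rfl h3
  rw [sem_dom] at h1
  rw [sem_mul] at h2
  have key : α = β := by
    by_cases hp : IsPrefix S β α
    · obtain ⟨b, hb, rfl⟩ := hp
      rw [sgeMul_left h1 h1 hb] at h2
      simp only [Option.some.injEq, Prod.mk.injEq] at h2
      have hgb : S.gs g = b.rng := by rw [← hb]; exact h1.2
      have hg : (β.comp b).src = (pact S g b).rng := by rw [pact_rng hgb]; exact h1.1.symm
      have := congrArg (fun p => p.toList.length) h2.1
      simp only [comp_toList hg, List.length_append, pact_toList hgb, length_actL] at this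
      have hl : b = Path.vert S β.src := Path.ext' hb.symm (List.length_eq_zero_iff.1 (by omega))
      rw [hl, comp_vert _ _ rfl]
    · by_cases hp' : IsPrefix S α β
      · obtain ⟨b, hb, rfl⟩ := hp'
        rw [sgeMul_right h1 h1 hb] at h2
        simp only [Option.some.injEq, Prod.mk.injEq] at h2
        have hgb : S.gs (S.inv g) = b.rng := by rw [S.gs_inv, ← hb]; exact h1.1
        have hg : (α.comp b).src = (pact S (S.inv g) b).rng := by
          rw [pact_rng hgb, S.gr_inv]; exact h1.2.symm
        have := congrArg (fun p => p.toList.length) h2.2.2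
        simp only [comp_toList hg, List.length_append, pact_toList hgb, length_actL] at this
        have hl : b = Path.vert S α.src := Path.ext' hb.symm (List.length_eq_zero_iff.1 (by omega))
        rw [hl, comp_vert _ _ rfl]
      · rw [sgeMul_none hp hp'] at h2
        simp at h2
  subst key
  rw [sgeMul_left' h1 h1 rfl] at h2
  simp only [Option.some.injEq, Prod.mk.injEq] at h2
  have hs : S.gs g = S.gr g := h1.2.trans h1.1.symm
  have := idem_one g hs h2.2.1
  refine ⟨α, ?_⟩
  rw [this, show S.gs g = α.src from h1.2, fIdem]

theorem le_fIdem {α β : Path S} :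
    (sgeSem S).le (fIdem S α) (fIdem S β) ↔ IsPrefix S β α := by
  change fIdem S α = sgeMul S (fIdem S β) (sgeMul S (sgeStar S (fIdem S α)) (fIdem S α)) ↔ _
  rw [star_fIdem, mul_fIdem_left (isPrefix_refl α)]
  constructor
  · intro h
    by_cases hc : IsPrefix S β α
    · exact hc
    · by_cases hc' : IsPrefix S α β
      · rw [mul_fIdem_right hc'] at h
        rw [fIdem_inj h]; exact isPrefix_refl _
      · rw [mul_fIdem_none (by rintro (h | h) <;> contradiction)] at h
        simp [fIdem] at h
  · intro h; rw [mul_fIdem_left h]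

theorem not_le_none {α : Path S} : ¬ (sgeSem S).le (fIdem S α) none := by
  intro h
  simp [RawSem.le, sem_mul, sgeMul, fIdem] at h

theorem star_mul_self {α γ : Path S} {g : S.G} (w : SGE.wf S (some (α, g, γ))) :
    sgeMul S (sgeStar S (some (α, g, γ))) (some (α, g, γ)) = fIdem S γ := by
  have hw : SGE.wf S (some (γ, S.inv g, α)) := ⟨(S.gr_inv g).trans w.2, (S.gs_inv g).trans w.1⟩
  rw [sgeStar, sgeMul_left' hw w rfl, S.inv_mul', fIdem, show S.gs g = γ.src from w.2]

theorem conj_fIdem {α γ b : Path S} {g : S.G} (w : SGE.wf S (some (α, g, γ)))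
    (hb : γ.src = b.rng) :
    sgeMul S (sgeMul S (some (α, g, γ)) (fIdem S (γ.comp b))) (sgeStar S (some (α, g, γ))) =
      fIdem S (α.comp (pact S g b)) := by
  have hw : SGE.wf S (some (γ, S.inv g, α)) := ⟨(S.gr_inv g).trans w.2, (S.gs_inv g).trans w.1⟩
  have hgb : S.gs g = b.rng := by rw [← hb]; exact w.2
  have hc : α.src = (pact S g b).rng := by rw [pact_rng hgb]; exact w.1.symm
  have hone : S.mul (pres S g b) (S.one (γ.comp b).src) = pres S g b := by
    rw [comp_src hb, ← pres_gs hgb, S.mul_one']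
  rw [fIdem, sgeMul_left w (wf_fIdem _) hb, hone, sgeStar, sgeMul_right _ hw hb, inv_inv',
    S.mul_inv', ← pact_src hgb, fIdem, comp_src hc]
  constructor
  · rw [comp_src hc, pact_src hgb]
  · rw [comp_src hb, pres_gs hgb]

theorem le_mul_elim {β ε γ : Path S}
    (h : (sgeSem S).le (fIdem S β) (sgeMul S (fIdem S ε) (fIdem S γ))) :
    IsPrefix S ε β ∧ IsPrefix S γ β := by
  by_cases h1 : IsPrefix S ε γ
  · rw [mul_fIdem_left h1, le_fIdem] at h
    exact ⟨isPrefix_trans h1 h, h⟩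
  · by_cases h2 : IsPrefix S γ ε
    · rw [mul_fIdem_right h2, le_fIdem] at h
      exact ⟨h, isPrefix_trans h2 h⟩
    · rw [mul_fIdem_none (by rintro (h | h) <;> contradiction)] at h
      exact absurd h not_le_none

theorem covers_iff (F : Set (SGE S)) (p : Path S) :
    (sgeSem S).Covers F (fIdem S p) ↔
      ∀ z, IsPrefix S p z → ∃ f ∈ F, sgeMul S (fIdem S z) f ≠ none := by
  constructor
  · intro h z hz
    exact h _ (nzIdem_fIdem z) (le_fIdem.2 hz)
  · intro h z hz hle
    obtain ⟨z, rfl⟩ := nzIdem_elim hz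
    exact h z (le_fIdem.1 hle)

theorem comparable_of_prefix {p q r : Path S} (h1 : IsPrefix S p r) (h2 : IsPrefix S q r) :
    Comparable S p q := by
  unfold Comparable
  simp only [isPrefix_iff] at *
  rcases List.prefix_or_prefix_of_prefix h1.2 h2.2 with h | h
  · exact Or.inl ⟨h1.1.trans h2.1.symm, h⟩
  · exact Or.inr ⟨h2.1.trans h1.1.symm, h⟩

/-- Data extracted from an element `s` and an idempotent below `e s* s`. -/
theorem dom_elim {ε : Path S} {s f : SGE S} (hs : (sgeSem S).dom s) (hf : (sgeSem S).NzIdem f)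
    (hle : (sgeSem S).le f ((sgeSem S).mul (fIdem S ε)
      ((sgeSem S).mul ((sgeSem S).star s) s))) :
    ∃ α g γ, s = some (α, g, γ) ∧ SGE.wf S (some (α, g, γ)) := by
  obtain ⟨b, rfl⟩ := nzIdem_elim hf
  rcases s with _ | ⟨α, g, γ⟩
  · exact absurd hle not_le_none
  · exact ⟨α, g, γ, rfl, hs⟩

theorem below_elim {ε α γ : Path S} {g : S.G} {f : SGE S} (w : SGE.wf S (some (α, g, γ)))
    (hf : (sgeSem S).NzIdem f)
    (hle : (sgeSem S).le f ((sgeSem S).mul (fIdem S ε)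
      ((sgeSem S).mul ((sgeSem S).star (some (α, g, γ))) (some (α, g, γ))))) :
    ∃ b, γ.src = b.rng ∧ f = fIdem S (γ.comp b) ∧ IsPrefix S ε (γ.comp b) ∧
      (sgeSem S).mul ((sgeSem S).mul (some (α, g, γ)) f) ((sgeSem S).star (some (α, g, γ))) =
        fIdem S (α.comp (pact S g b)) := by
  obtain ⟨b, rfl⟩ := nzIdem_elim hf
  rw [sem_mul, sem_star] at hle
  rw [star_mul_self w] at hle
  obtain ⟨h1, b', hb', rfl⟩ := le_mul_elim hle
  exact ⟨b', hb', rfl, h1, conj_fIdem w hb'⟩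

/-- (2) implies (1). -/
theorem str_imp_loc (h : (sgeSem S).StrLocContr) : (sgeSem S).LocContr := by
  intro e he
  obtain ⟨s, f₀, f₁, hs, hf₀, hf₁, h01, h1e, hle, h0⟩ := h e he
  obtain ⟨ε, rfl⟩ := nzIdem_elim he
  obtain ⟨α, g, γ, rfl, w⟩ := dom_elim hs hf₁ h1e
  obtain ⟨b, hb, rfl, hε, hconj⟩ := below_elim w hf₁ h1e
  obtain ⟨c, rfl⟩ := nzIdem_elim hf₀
  have h01' := le_fIdem.1 h01
  have hγ : IsPrefix S γ c := isPrefix_trans (isPrefix_comp hb) h01'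
  obtain ⟨c, hc, rfl⟩ := hγ
  have hconj0 : (sgeSem S).mul ((sgeSem S).mul (some (α, g, γ)) (fIdem S (γ.comp c)))
      ((sgeSem S).star (some (α, g, γ))) = fIdem S (α.comp (pact S g c)) := conj_fIdem w hc
  rw [hconj] at h0 hle
  rw [le_fIdem] at hle
  have hgb : S.gs g = b.rng := by rw [← hb]; exact w.2
  have hgc : S.gs g = c.rng := by rw [← hc]; exact w.2
  have hbc : IsPrefix S (α.comp (pact S g b)) (α.comp (pact S g c)) := by
    have e1 : α.src = (pact S g b).rng := by rw [pact_rng hgb]; exact w.1.symm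
    have e2 : α.src = (pact S g c).rng := by rw [pact_rng hgc]; exact w.1.symm
    rw [isPrefix_iff, comp_rng, comp_rng, comp_toList e1, comp_toList e2,
      List.prefix_append_right_inj, pact_toList hgb, pact_toList hgc]
    refine ⟨rfl, actL_prefix _ ?_⟩
    rw [isPrefix_iff, comp_toList hb, comp_toList hc, List.prefix_append_right_inj] at h01'
    exact h01'.2
  rw [sem_mul, sem_zero] at h0
  have h0' := (mul_fIdem_eq_none _ _).1 h0
  refine ⟨some (α, g, γ), hs, {fIdem S (γ.comp c), fIdem S (γ.comp b)}, fIdem S (γ.comp c),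
    by simp, ?_, ?_⟩
  · intro f hf
    simp only [Finset.mem_insert, Finset.mem_singleton] at hf
    have hle' := h1e
    rw [sem_mul, sem_star] at h1e
    rw [star_mul_self w] at h1e
    rcases hf with rfl | rfl
    · refine ⟨nzIdem_fIdem _, ?_⟩
      rw [sem_mul, sem_star]
      rw [star_mul_self w]
      by_cases hp : IsPrefix S ε γ
      · rw [mul_fIdem_left hp, le_fIdem]; exact isPrefix_comp hc
      · have hp' : IsPrefix S γ ε :=
          (comparable_of_prefix hε (isPrefix_comp hb)).resolve_left hp
        rw [mul_fIdem_right hp', le_fIdem]; exact isPrefix_trans hε h01'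
    · exact ⟨hf₁, hle'⟩
  · intro f hf
    simp only [Finset.mem_insert, Finset.mem_singleton] at hf
    rcases hf with rfl | rfl
    · rw [hconj0]
      constructor
      · rw [covers_iff]
        intro z hz
        refine ⟨fIdem S (γ.comp b), by simp, ?_⟩
        rw [Ne, mul_fIdem_eq_none, not_not]
        exact Or.inr (isPrefix_trans hle (isPrefix_trans hbc hz))
      · refine (mul_fIdem_eq_none _ _).2 ?_
        rintro (h | h)
        · exact h0' (comparable_of_prefix h hbc)
        · exact h0' (Or.inr (isPrefix_trans hbc h))
    · rw [hconj]
      constructor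
      · rw [covers_iff]
        intro z hz
        refine ⟨fIdem S (γ.comp b), by simp, ?_⟩
        rw [Ne, mul_fIdem_eq_none, not_not]
        exact Or.inr (isPrefix_trans hle hz)
      · exact h0

end SSA

namespace SSA

variable {S : SSA}

/-- Comparability of lists for the prefix order. -/
def Cmp {X : Type} (l m : List X) : Prop := l <+: m ∨ m <+: l

theorem Cmp.symm {X : Type} {l m : List X} (h : Cmp l m) : Cmp m l := Or.symm h

theorem cmp_of_prefix {X : Type} {l m n : List X} (h1 : l <+: n) (h2 : m <+: n) : Cmp l m :=
  List.prefix_or_prefix_of_prefix h1 h2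

theorem cmp_append {X : Type} (k l m : List X) : Cmp (k ++ l) (k ++ m) ↔ Cmp l m := by
  simp [Cmp, List.prefix_append_right_inj]

theorem cmp_prefix_left {X : Type} {l m n : List X} (h : Cmp m n) (h1 : l <+: m) : Cmp l n := by
  rcases h with h | h
  · exact Or.inl (h1.trans h)
  · exact cmp_of_prefix h1 h

/-- The purely length-preserving case is impossible. -/
theorem no_isometric_contraction {X : Type} (W : Set (List X))
    (hW : ∀ l m, l <+: m → m ∈ W → l ∈ W)
    (φ ψ : List X → List X) (hφ : ∀ l ∈ W, φ l ∈ W) (hψ : ∀ l ∈ W, ψ l ∈ W)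
    (hψφ : ∀ l ∈ W, ψ (φ l) = l) (hφψ : ∀ l ∈ W, φ (ψ l) = l)
    (len : ∀ l, (φ l).length = l.length)
    (pφ : ∀ l m, l <+: m → φ l <+: φ m) (pψ : ∀ l m, l <+: m → ψ l <+: ψ m)
    (F : Set (List X)) (hF : F.Finite) (hFW : ∀ b ∈ F, b ∈ W) (b0 : List X) (hb0 : b0 ∈ F)
    (hcov : ∀ b ∈ F, ∀ z ∈ W, φ b <+: z → ∃ b' ∈ F, Cmp z b')
    (hinc : ∀ b ∈ F, ¬ Cmp b0 (φ b)) : False := by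
  have hiW : ∀ n, ∀ l ∈ W, φ^[n] l ∈ W := by
    intro n
    induction n with
    | zero => intro l hl; exact hl
    | succ n ih => intro l hl; rw [Function.iterate_succ_apply']; exact hφ _ (ih l hl)
  have hip : ∀ n l m, l <+: m → φ^[n] l <+: φ^[n] m := by
    intro n
    induction n with
    | zero => intro l m h; exact h
    | succ n ih =>
      intro l m h
      rw [Function.iterate_succ_apply', Function.iterate_succ_apply']; exact pφ _ _ (ih l m h)
  have hil : ∀ n l, (φ^[n] l).length = l.length := by
    intro n
    induction n with
    | zero => intro l; rfl
    | succ n ih => intro l; rw [Function.iterate_succ_apply', len, ih]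
  have hinj : ∀ l ∈ W, ∀ m ∈ W, φ l = φ m → l = m := by
    intro l hl m hm h
    rw [← hψφ l hl, h, hψφ m hm]
  -- the set of points all of whose extensions meet `F`
  let C : Set (List X) := {x | x ∈ W ∧ ∀ z ∈ W, x <+: z → ∃ b ∈ F, Cmp z b}
  have hCφ : ∀ x ∈ C, φ x ∈ C := by
    rintro x ⟨hx, hx'⟩
    refine ⟨hφ x hx, fun z hz hxz => ?_⟩
    have h1 : x <+: ψ z := by
      have := pψ _ _ hxz
      rwa [hψφ x hx] at this
    obtain ⟨b, hb, hc | hc⟩ := hx' (ψ z) (hψ z hz) h1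
    · have h2 := pφ _ _ hc
      rw [hφψ z hz] at h2
      obtain ⟨b', hb', h3⟩ := hcov b hb (φ b) (hφ b (hFW b hb)) (List.prefix_refl _)
      exact ⟨b', hb', cmp_prefix_left h3 h2⟩
    · have h2 := pφ _ _ hc
      rw [hφψ z hz] at h2
      exact hcov b hb z hz h2
  have hCi : ∀ n, ∀ x ∈ C, φ^[n] x ∈ C := by
    intro n
    induction n with
    | zero => intro l hl; exact hl
    | succ n ih => intro l hl; rw [Function.iterate_succ_apply']; exact hCφ _ (ih l hl)
  have hCF : ∀ b ∈ F, ∀ z ∈ W, b <+: z → z ∈ C := by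
    intro b hb z hz hbz
    exact ⟨hz, fun y _ hy => ⟨b, hb, Or.inr (hbz.trans hy)⟩⟩
  have hb0W := hFW b0 hb0
  have hb0C : b0 ∈ C := hCF b0 hb0 b0 hb0W (List.prefix_refl _)
  -- main contradiction
  have main : ∀ y ∈ C, ¬ (φ y <+: b0) := by
    rintro y ⟨hy, hy'⟩ h
    have h1 := pψ _ _ h
    rw [hψφ y hy] at h1
    obtain ⟨b, hb, hc⟩ := hy' (ψ b0) (hψ _ hb0W) h1
    apply hinc b hb
    rcases hc with hc | hc
    · have := pφ _ _ hc
      rw [hφψ _ hb0W] at this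
      exact Or.inl this
    · have := pφ _ _ hc
      rw [hφψ _ hb0W] at this
      exact Or.inr this
  let per : ℕ → Prop := fun k => ∃ d, φ^[d + 1] (b0.take k) = b0.take k
  have htW : ∀ k, b0.take k ∈ W := fun k => hW _ _ (List.take_prefix k b0) hb0W
  have per0 : per 0 := ⟨0, List.length_eq_zero_iff.1 (by simp [len])⟩
  have perL : ¬ per b0.length := by
    rintro ⟨d, hd⟩
    rw [List.take_length, Function.iterate_succ_apply'] at hd
    exact main _ (hCi d _ hb0C) (by rw [hd])
  obtain ⟨k, hk, hk'⟩ : ∃ k, per k ∧ ¬ per (k + 1) := by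
    by_contra hcon
    push Not at hcon
    have : ∀ k, per k := by
      intro k
      induction k with
      | zero => exact per0
      | succ k ih => exact hcon k ih
    exact perL (this _)
  -- the orbit of `take (k+1) b0` is infinite
  have horb : Function.Injective (fun n => φ^[n] (b0.take (k + 1))) := by
    have hlt : ∀ m n, m < n → φ^[m] (b0.take (k + 1)) ≠ φ^[n] (b0.take (k + 1)) := by
      intro m
      induction m with
      | zero =>
        intro n hn h
        obtain ⟨d, rfl⟩ : ∃ d, n = d + 1 := ⟨n - 1, by omega⟩
        exact hk' ⟨d, h.symm⟩
      | succ m ih =>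
        intro n hn h
        obtain ⟨d, rfl⟩ : ∃ d, n = d + 1 := ⟨n - 1, by omega⟩
        rw [Function.iterate_succ_apply', Function.iterate_succ_apply'] at h
        exact ih d (by omega) (hinj _ (hiW _ _ (htW _)) _ (hiW _ _ (htW _)) h)
    intro m n h
    rcases lt_trichotomy m n with h1 | h1 | h1
    · exact absurd h (hlt m n h1)
    · exact h1
    · exact absurd h.symm (hlt n m h1)
  have hfin : {l : List X | ∃ b ∈ F, l <+: b}.Finite := by
    have : {l : List X | ∃ b ∈ F, l <+: b} = ⋃ b ∈ F, {l | l ∈ b.inits} := by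
      ext l; simp
    rw [this]
    exact hF.biUnion fun b _ => List.finite_toSet _
  obtain ⟨n, hn⟩ : ∃ n, φ^[n] (b0.take (k + 1)) ∉ {l : List X | ∃ b ∈ F, l <+: b} := by
    by_contra hcon
    push Not at hcon
    exact Set.infinite_of_injective_forall_mem horb hcon hfin
  have hnC : φ^[n] (b0.take k) ∈ C := by
    obtain ⟨f, hf, hc⟩ := (hCi n _ hb0C).2 _ (hiW n _ hb0W) (List.prefix_refl _)
    have hpk : φ^[n] (b0.take (k + 1)) <+: φ^[n] b0 := hip _ _ _ (List.take_prefix _ _)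
    have hpk0 : φ^[n] (b0.take k) <+: φ^[n] b0 := hip _ _ _ (List.take_prefix _ _)
    rcases hc with hc | hc
    · exact absurd ⟨f, hf, hpk.trans hc⟩ hn
    · have hlen : ¬ (φ^[n] (b0.take (k + 1))).length ≤ f.length := fun hle =>
        hn ⟨f, hf, List.prefix_of_prefix_length_le hpk hc hle⟩
      have hlt : k < b0.length := by
        by_contra hcon
        apply hk'
        obtain ⟨d, hd⟩ := hk
        have : b0.take (k + 1) = b0.take k := by
          rw [List.take_of_length_le (by omega), List.take_of_length_le (by omega)]
        exact ⟨d, by rw [this, hd]⟩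
      have : f <+: φ^[n] (b0.take k) := by
        apply List.prefix_of_prefix_length_le hc hpk0
        rw [hil, List.length_take] at hlen ⊢
        omega
      exact hCF f hf _ (hiW _ _ (htW _)) this
  obtain ⟨d, hd⟩ := hk
  have hper : ∀ j, φ^[(d + 1) * j] (b0.take k) = b0.take k := by
    intro j
    rw [Function.iterate_mul]
    exact Function.iterate_fixed hd j
  have hj := hCi (d * n + d) _ hnC
  rw [← Function.iterate_add_apply] at hj
  apply main _ hj
  rw [← Function.iterate_succ_apply' φ]
  have : (d * n + d + n).succ = (d + 1) * (n + 1) := by rw [Nat.succ_eq_add_one]; ring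
  rw [this, hper]
  exact List.take_prefix _ _

/-! ### Entrances -/

theorem entrance_transport (g : S.G) (h : HasEntranceVert S (S.gs g)) :
    HasEntranceVert S (S.gr g) := by
  obtain ⟨e, f, hne, he, hf⟩ := h
  refine ⟨S.act g e, S.act g f, fun h => hne ?_, S.er_act _ _ he.symm, S.er_act _ _ hf.symm⟩
  rw [← act_inv_act g e he.symm, h, act_inv_act g f hf.symm]

theorem entrance_transport' (g : S.G) (h : HasEntranceVert S (S.gr g)) :
    HasEntranceVert S (S.gs g) := by
  have := entrance_transport (S.inv g)
  rw [S.gs_inv, S.gr_inv] at this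
  exact this h

theorem endV_append (v : S.V) (l m : List S.E) :
    endV S v (l ++ m) = endV S (endV S v l) m := by
  induction l generalizing v with
  | nil => rfl
  | cons e l ih => simp [endV, ih]

theorem base_aux (v : S.V) (l : List S.E) (w : S.V) :
    (∃ m, m <+: l ∧ w = endV S v m) ↔ (w = v ∨ ∃ e ∈ l, S.es e = w) := by
  induction l generalizing v with
  | nil => simp [endV]
  | cons a l ih =>
    constructor
    · rintro ⟨m, hm, rfl⟩
      rcases m with _ | ⟨b, m⟩
      · left; rfl
      · rw [List.cons_prefix_cons] at hm
        obtain ⟨rfl, hm⟩ := hm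
        right
        rcases (ih (S.es b)).1 ⟨m, hm, rfl⟩ with h | ⟨e, he, h⟩
        · exact ⟨b, by simp, h.symm⟩
        · exact ⟨e, by simp [he], h⟩
    · rintro (rfl | ⟨e, he, h⟩)
      · exact ⟨[], List.nil_prefix, rfl⟩
      · have : w = S.es a ∨ ∃ e ∈ l, S.es e = w := by
          rcases List.mem_cons.1 he with rfl | he
          · exact Or.inl h.symm
          · exact Or.inr ⟨e, he, h⟩
        obtain ⟨m, hm, hw⟩ := (ih (S.es a)).2 this
        exact ⟨a :: m, by rw [List.cons_prefix_cons]; exact ⟨rfl, hm⟩, hw⟩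

theorem mem_baseVerts (p : Path S) (w : S.V) :
    w ∈ p.baseVerts ↔ ∃ m, m <+: p.toList ∧ w = endV S p.rng m := by
  rw [base_aux]; rfl

/-- No vertex reachable from `v` has an entrance. -/
def Thin (S : SSA) (v : S.V) : Prop := ∀ l, vld S v l → ¬ HasEntranceVert S (endV S v l)

theorem cmp_of_noEntrance {v : S.V} (c p : List S.E) (hc : vld S v c) (hp : vld S v p)
    (h : ∀ l, l <+: c → ¬ HasEntranceVert S (endV S v l)) : Cmp c p := by
  induction c generalizing v p with
  | nil => exact Or.inl List.nil_prefix
  | cons a c ih =>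
    rcases p with _ | ⟨b, p⟩
    · exact Or.inr List.nil_prefix
    · obtain ⟨ha, hc⟩ := hc
      obtain ⟨hb, hp⟩ := hp
      have hab : a = b := by
        by_contra hne
        exact h [] List.nil_prefix ⟨a, b, hne, ha, hb⟩
      subst hab
      have := ih p hc hp (fun l hl => h (a :: l) (by rw [List.cons_prefix_cons]; exact ⟨rfl, hl⟩))
      simpa [Cmp, List.cons_prefix_cons] using this

theorem Thin.cmp {v : S.V} (h : Thin S v) {l m : List S.E} (hl : vld S v l) (hm : vld S v m) :
    Cmp l m :=
  cmp_of_noEntrance l m hl hm fun k hk => h k (vld_prefix hk hl)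

theorem thin_of_cycle (g : S.G) (c : List S.E) (hc : vld S (S.gr g) c) (hne : c ≠ [])
    (hg : S.gs g = endV S (S.gr g) c)
    (h : ∀ l, l <+: c → ¬ HasEntranceVert S (endV S (S.gr g) l)) : Thin S (S.gr g) := by
  have key : ∀ n, ∀ p : List S.E, p.length = n → vld S (S.gr g) p →
      ¬ HasEntranceVert S (endV S (S.gr g) p) := by
    intro n
    induction n using Nat.strong_induction_on with
    | _ n ih =>
      intro p hn hp
      rcases cmp_of_noEntrance c p hc hp h with ⟨q, rfl⟩ | hpc
      · rw [vld_append, ← hg] at hp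
        have hlen : 0 < c.length := List.length_pos_iff.2 hne
        have h1 := ih (actL S g q).length (by rw [length_actL, ← hn, List.length_append]; omega)
          (actL S g q) rfl (actL_vld g q hp.2)
        rw [← gr_resL g q hp.2] at h1
        rw [endV_append, ← hg, ← gs_resL g q hp.2]
        exact fun h2 => h1 (entrance_transport _ h2)
      · exact h p hpc
  exact fun l hl => key _ l rfl hl

theorem thin_of_gcycle {g : S.G} {c : Path S} (hc : GCycle S g c) (h : ¬ c.hasEntrance) :
    Thin S c.rng := by
  obtain ⟨h1, h2, h3⟩ := hc
  rw [← h3]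
  apply thin_of_cycle g c.toList
  · rw [h3]; exact c.vld
  · intro hnil
    rw [Path.length_eq, hnil] at h1
    simp at h1
  · rw [h2, Path.src_eq, h3]
  · intro l hl he
    rw [h3] at he
    exact h ⟨_, (mem_baseVerts _ _).2 ⟨l, hl, rfl⟩, he⟩

/-! ### Local contraction in terms of lists -/

theorem comparable_iff (p q : Path S) :
    Comparable S p q ↔ p.rng = q.rng ∧ Cmp p.toList q.toList := by
  unfold Comparable Cmp
  rw [isPrefix_iff, isPrefix_iff]
  constructor
  · rintro (⟨h1, h2⟩ | ⟨h1, h2⟩)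
    · exact ⟨h1, Or.inl h2⟩
    · exact ⟨h1.symm, Or.inr h2⟩
  · rintro ⟨h1, h2 | h2⟩
    · exact Or.inl ⟨h1, h2⟩
    · exact Or.inr ⟨h1.symm, h2⟩

theorem loc_elim (h : (sgeSem S).LocContr) (v : S.V) :
    ∃ (A C : List S.E) (g : S.G) (F : Set (List S.E)) (b0 : List S.E),
      vld S v A ∧ vld S v C ∧ S.gr g = endV S v A ∧ S.gs g = endV S v C ∧ F.Finite ∧ b0 ∈ F ∧
      (∀ b ∈ F, vld S (S.gs g) b) ∧
      (∀ b ∈ F, ∀ z, vld S v z → A ++ actL S g b <+: z → ∃ b' ∈ F, Cmp z (C ++ b')) ∧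
      (∀ b ∈ F, ¬ Cmp (C ++ b0) (A ++ actL S g b)) := by
  obtain ⟨s, hs, F, f₀, hf₀, hF, hcon⟩ := h _ (nzIdem_fIdem (Path.vert S v))
  obtain ⟨α, g, γ, rfl, w⟩ := dom_elim hs (hF f₀ hf₀).1 (hF f₀ hf₀).2
  have hF' := fun f hf => below_elim w (hF f hf).1 (hF f hf).2
  obtain ⟨b0, hb0, hb0f, hε, hconj0⟩ := hF' f₀ hf₀
  have hγ : γ.rng = v := by
    rw [isPrefix_iff, comp_rng] at hε
    exact hε.1.symm
  have wr : S.gr g = α.src := w.1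
  have ws : S.gs g = γ.src := w.2
  have hα : α.rng = v := by
    have h1 := (hcon f₀ hf₀).1
    rw [hconj0, covers_iff] at h1
    obtain ⟨f, hf, h2⟩ := h1 _ (isPrefix_refl _)
    obtain ⟨b, hb, rfl, -, -⟩ := hF' f hf
    rw [Ne, mul_fIdem_eq_none, not_not, comparable_iff, comp_rng, comp_rng] at h2
    rw [h2.1, hγ]
  refine ⟨α.toList, γ.toList, g,
    {l | ∃ b : Path S, γ.src = b.rng ∧ fIdem S (γ.comp b) ∈ F ∧ l = b.toList}, b0.toList,
    by rw [← hα]; exact α.vld, by rw [← hγ]; exact γ.vld, by rw [wr, Path.src_eq, hα],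
    by rw [ws, Path.src_eq, hγ], ?_, ⟨b0, hb0, by rw [← hb0f]; exact hf₀, rfl⟩, ?_, ?_, ?_⟩
  · apply (F.finite_toSet.image (fun x : SGE S => match x with
      | none => []
      | some (a, _, _) => a.toList.drop γ.toList.length)).subset
    rintro l ⟨b, hb, hbF, rfl⟩
    refine ⟨_, hbF, ?_⟩
    simp [fIdem, comp_toList hb]
  · rintro l ⟨b, hb, -, rfl⟩
    rw [ws, hb]; exact b.vld
  · rintro l ⟨b, hb, hbF, rfl⟩ z hz hp
    have hgb : S.gs g = b.rng := ws.trans hb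
    have hc : α.src = (pact S g b).rng := by rw [pact_rng hgb, wr]
    have h1 := (hcon _ hbF).1
    rw [sem_mul, sem_star, conj_fIdem w hb, covers_iff] at h1
    obtain ⟨z, hzr, rfl⟩ := exists_path v z hz
    obtain ⟨f, hf, h2⟩ := h1 z (by
      rw [isPrefix_iff, comp_rng, comp_toList hc, pact_toList hgb, hα]
      exact ⟨hzr.symm, hp⟩)
    obtain ⟨b', hb', rfl, -, -⟩ := hF' f hf
    rw [Ne, mul_fIdem_eq_none, not_not, comparable_iff, comp_toList hb'] at h2
    exact ⟨b'.toList, ⟨b', hb', hf, rfl⟩, h2.2⟩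
  · rintro l ⟨b, hb, hbF, rfl⟩ hcmp
    have hgb : S.gs g = b.rng := ws.trans hb
    have hc : α.src = (pact S g b).rng := by rw [pact_rng hgb, wr]
    have h1 := (hcon _ hbF).2
    rw [sem_mul, sem_star, conj_fIdem w hb, hb0f, sem_zero, mul_fIdem_eq_none, comparable_iff] at h1
    apply h1
    rw [comp_rng, comp_rng, hα, hγ, comp_toList hb0, comp_toList hc, pact_toList hgb]
    exact ⟨rfl, hcmp⟩

/-- The final assertion: (1) implies that every `G`-cycle has an entrance. -/
theorem loc_imp_cyc (h : (sgeSem S).LocContr) : CondCyc S := by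
  intro g p hp
  by_contra hne
  have ht := thin_of_gcycle hp hne
  obtain ⟨A, C, g, F, b0, hA, hC, hr, hs, -, hb0, hFv, -, hinc⟩ := loc_elim h p.rng
  apply hinc b0 hb0
  apply ht.cmp
  · rw [vld_append, ← hs]; exact ⟨hC, hFv _ hb0⟩
  · rw [vld_append, ← hr]; exact ⟨hA, actL_vld _ _ (hFv _ hb0)⟩

theorem loc_imp_con (h : (sgeSem S).LocContr) : CondCon S := by
  have hcyc := loc_imp_cyc h
  intro v
  obtain ⟨A, C, g, F, b0, hA, hC, hr, hs, hFf, hb0, hFv, hcov, hinc⟩ := loc_elim h v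
  have hcmp : Cmp A C := by
    obtain ⟨b', hb', h1⟩ := hcov b0 hb0 _
      (by rw [vld_append, ← hr]; exact ⟨hA, actL_vld _ _ (hFv _ hb0)⟩) (List.prefix_refl _)
    have h2 := cmp_prefix_left h1 (List.prefix_append A _)
    exact (cmp_prefix_left h2.symm (List.prefix_append C _)).symm
  by_cases hAC : A = C
  · exfalso
    subst hAC
    have hrs : S.gr g = S.gs g := hr.trans hs.symm
    refine no_isometric_contraction {l | vld S (S.gs g) l} (fun l m => vld_prefix)
      (actL S g) (actL S (S.inv g)) ?_ ?_ ?_ ?_ (length_actL g) (fun l m => actL_prefix g)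
      (fun l m => actL_prefix _) F hFf hFv b0 hb0 ?_ ?_
    · intro l hl
      have := actL_vld g l hl
      rwa [hrs] at this
    · intro l hl
      have := actL_vld (S.inv g) l (by rw [S.gs_inv, hrs]; exact hl)
      rwa [S.gr_inv] at this
    · exact fun l hl => actL_inv g l hl
    · exact fun l hl => actL_inv' g l (by rw [hrs]; exact hl)
    · intro b hb z hz hp
      obtain ⟨b', hb', h1⟩ := hcov b hb (A ++ z)
        (by rw [vld_append, ← hs]; exact ⟨hA, hz⟩) (by rwa [List.prefix_append_right_inj])
      exact ⟨b', hb', (cmp_append _ _ _).1 h1⟩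
    · intro b hb h1
      exact hinc b hb ((cmp_append _ _ _).2 h1)
  · rcases hcmp with ⟨t, rfl⟩ | ⟨t, rfl⟩
    · have ht : t ≠ [] := by rintro rfl; simp at hAC
      rw [vld_append] at hC
      obtain ⟨p, hp, hpl⟩ := exists_path v A hA
      obtain ⟨c, hc, hcl⟩ := exists_path _ t hC.2
      have hcy : GCycle S g c := by
        refine ⟨?_, ?_, ?_⟩
        · rw [Path.length_eq, hcl]; exact List.length_pos_iff.2 ht
        · rw [Path.src_eq, hc, hcl, hs, endV_append]
        · rw [hr, hc]
      refine ⟨p, hp, g, c, hcy, hcyc _ _ hcy, ?_⟩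
      rw [Path.src_eq, hp, hpl, ← hc]
      exact Set.mem_insert _ _
    · have ht : t ≠ [] := by rintro rfl; simp at hAC
      rw [vld_append] at hA
      obtain ⟨p, hp, hpl⟩ := exists_path v C hC
      obtain ⟨c, hc, hcl⟩ := exists_path _ t hA.2
      have hcy : GCycle S (S.inv g) c := by
        refine ⟨?_, ?_, ?_⟩
        · rw [Path.length_eq, hcl]; exact List.length_pos_iff.2 ht
        · rw [S.gs_inv, Path.src_eq, hc, hcl, hr, endV_append]
        · rw [S.gr_inv, hs, hc]
      refine ⟨p, hp, S.inv g, c, hcy, hcyc _ _ hcy, ?_⟩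
      rw [Path.src_eq, hp, hpl, ← hc]
      exact Set.mem_insert _ _

/-- A `G`-cycle with an entrance admits an incomparable path with the same range. -/
theorem exists_incomparable {g : S.G} {c : Path S} (hc : GCycle S g c) (h : c.hasEntrance) :
    ∃ m, vld S c.rng m ∧ ¬ Cmp m c.toList := by
  obtain ⟨h1, h2, h3⟩ := hc
  have hne : c.toList ≠ [] := by
    intro hnil
    rw [Path.length_eq, hnil] at h1
    simp at h1
  obtain ⟨l, hl, hll, he⟩ : ∃ l, l <+: c.toList ∧ l ≠ c.toList ∧
      HasEntranceVert S (endV S c.rng l) := by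
    obtain ⟨w, hw, he⟩ := h
    obtain ⟨l, hl, rfl⟩ := (mem_baseVerts _ _).1 hw
    by_cases hll : l = c.toList
    · refine ⟨[], List.nil_prefix, hne.symm, ?_⟩
      subst hll
      rw [← Path.src_eq, ← h2] at he
      change HasEntranceVert S c.rng
      rw [← h3]
      exact entrance_transport _ he
    · exact ⟨l, hl, hll, he⟩
  obtain ⟨t, ht⟩ := hl
  rcases t with _ | ⟨a, t⟩
  · exact absurd (by simpa using ht) hll
  have hv := c.vld
  rw [← ht, vld_append] at hv
  have key : ∀ e, e ≠ a → S.er e = endV S c.rng l → ∃ m, vld S c.rng m ∧ ¬ Cmp m c.toList := by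
    intro e hea he
    refine ⟨l ++ [e], ?_, ?_⟩
    · rw [vld_append]; exact ⟨hv.1, he, trivial⟩
    · rw [← ht, cmp_append]
      simp [Cmp, List.cons_prefix_cons, hea, Ne.symm hea]
  obtain ⟨e, f, hef, he1, hf1⟩ := he
  by_cases hea : e = a
  · exact key f (fun h => hef (hea.trans h.symm)) hf1
  · exact key e hea he1

theorem con_imp_str (h : CondCon S) : (sgeSem S).StrLocContr := by
  intro e he
  obtain ⟨ε, rfl⟩ := nzIdem_elim he
  obtain ⟨μ, hμ, g, c, hc, hent, hbase⟩ := h ε.src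
  obtain ⟨m, hm, hmc⟩ := exists_incomparable hc hent
  obtain ⟨-, h2, h3⟩ := hc
  obtain ⟨l, ⟨t, ht⟩, hsrc⟩ := (mem_baseVerts _ _).1 hbase
  have hcv := c.vld
  rw [← ht, vld_append, ← hsrc] at hcv
  obtain ⟨τ, hτ, hτl⟩ := exists_path _ t hcv.2
  have hτs : τ.src = S.gs g := by
    rw [h2, Path.src_eq, Path.src_eq c, hτ, hτl, ← ht, endV_append, hsrc]
  -- the path `λ`
  obtain ⟨L, hLε, hLs⟩ : ∃ L : Path S, IsPrefix S ε L ∧ L.src = S.gs g := by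
    refine ⟨(ε.comp μ).comp τ, ?_, ?_⟩
    · exact isPrefix_trans (isPrefix_comp hμ.symm)
        (isPrefix_comp (by rw [comp_src hμ.symm, hτ]))
    · rw [comp_src (by rw [comp_src hμ.symm, hτ]), hτs]
  have hgi : S.gs (S.inv g) = c.rng := (S.gs_inv g).trans h3
  have hLc : L.src = (pact S (S.inv g) c).rng := by rw [pact_rng hgi, S.gr_inv, hLs]
  have w : SGE.wf S (some (L.comp (pact S (S.inv g) c), pres S (S.inv g) c, L)) := by
    constructor
    · rw [comp_src hLc, pact_src hgi]
    · rw [pres_gs hgi, hLs, h2]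
  have hmv : vld S L.src (actL S (S.inv g) m) := by
    have := actL_vld (S.inv g) m (by rw [hgi]; exact hm)
    rwa [S.gr_inv, ← hLs] at this
  obtain ⟨q, hq, hql⟩ := exists_path _ _ hmv
  have hconj := conj_fIdem (b := Path.vert S L.src) w rfl
  rw [comp_vert _ _ rfl] at hconj
  have e2 : pact S (pres S (S.inv g) c) (Path.vert S L.src) =
    Path.vert S (S.gr (pres S (S.inv g) c)) := rfl
  rw [e2, comp_vert _ _ (by rw [comp_src hLc, pact_src hgi])] at hconj
  refine ⟨some (L.comp (pact S (S.inv g) c), pres S (S.inv g) c, L), fIdem S (L.comp q),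
    fIdem S L, w, nzIdem_fIdem _, nzIdem_fIdem _, le_fIdem.2 (isPrefix_comp hq.symm), ?_, ?_, ?_⟩
  · rw [sem_mul, sem_star, star_mul_self w, mul_fIdem_left hLε, le_fIdem]
    exact isPrefix_refl _
  · rw [sem_mul, sem_star, hconj, le_fIdem]
    exact isPrefix_comp hLc
  · rw [sem_mul, sem_star, hconj, sem_zero, mul_fIdem_eq_none, comparable_iff,
      comp_toList hq.symm, comp_toList hLc, cmp_append, pact_toList hgi, hql]
    rintro ⟨-, hcm⟩
    apply hmc
    have hm' : vld S (S.gs (S.inv g)) m := by rw [hgi]; exact hm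
    have hc' : vld S (S.gs (S.inv g)) c.toList := by rw [hgi]; exact c.vld
    rcases hcm with h4 | h4
    · have := actL_prefix (S.inv (S.inv g)) h4
      rw [actL_inv _ _ hm', actL_inv _ _ hc'] at this
      exact Or.inl this
    · have := actL_prefix (S.inv (S.inv g)) h4
      rw [actL_inv _ _ hm', actL_inv _ _ hc'] at this
      exact Or.inr this

end SSA

/-- The inverse semigroup `S(G,E)` is locally contracting iff it
is strongly locally contracting iff condition (Con) holds; and these conditions
imply that every `G`-cycle has an entrance. -/
theorem statement12 (S : SSA) :
    List.TFAE [(SSA.sgeSem S).LocContr, (SSA.sgeSem S).StrLocContr, SSA.CondCon S] ∧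
    ((SSA.sgeSem S).LocContr → SSA.CondCyc S) := by
  refine ⟨?_, SSA.loc_imp_cyc⟩
  tfae_have 1 → 3 := SSA.loc_imp_con
  tfae_have 3 → 2 := SSA.con_imp_str
  tfae_have 2 → 1 := SSA.str_imp_loc
  tfae_finish

end
end

section
/- Let S be an inverse semigroup with zero and let ω be a normalised 𝕋-valued 2-cocycle over S. Then for all s ∈ S∖{0} and all idempotents e,f ∈ E(S): (1) ω(s,s*) = ω(s*,s); (2) if e·f ≠ 0 then ω(e,f) = 1; (3) if 0 ≠ s*·s ≤ e then ω(s,e) = 1 and ω(e,s*) = 1; (4) if s·e ≠ 0 then ω(s,e) = ω(s·e·s*, s). -/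
/-- An inverse semigroup with zero: a semigroup with a zero element and an
involution `star` providing (necessarily unique) generalized inverses, in which
all idempotents commute. -/
structure InvSemZ where
  T : Type
  mul : T → T → T
  star : T → T
  zero : T
  mul_assoc' : ∀ a b c, mul (mul a b) c = mul a (mul b c)
  zero_mul' : ∀ a, mul zero a = zero
  mul_zero' : ∀ a, mul a zero = zero
  gen_inv₁ : ∀ a, mul (mul a (star a)) a = a
  gen_inv₂ : ∀ a, mul (mul (star a) a) (star a) = star a
  idem_comm : ∀ e f, mul e e = e → mul f f = f → mul e f = mul f e

namespace InvSemZ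

variable (Q : InvSemZ)

/-- Idempotents. -/
def IsIdem (e : Q.T) : Prop := Q.mul e e = e

/-- The natural partial order: `t ≤ u` iff `t = u ⬝ t* ⬝ t`. -/
def le (t u : Q.T) : Prop := t = Q.mul u (Q.mul (Q.star t) t)

/-- A normalised `𝕋`-valued `2`-cocycle over the inverse semigroup `Q`:
a family of unimodular complex numbers `ω s t` (meaningful when `s ⬝ t ≠ 0`)
satisfying the cocycle identity whenever `r ⬝ s ⬝ t ≠ 0`, and `ω e e = 1` on
nonzero idempotents. -/
def IsCocycle (ω : Q.T → Q.T → ℂ) : Prop :=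
  (∀ s t, Q.mul s t ≠ Q.zero → ‖ω s t‖ = 1) ∧
  (∀ r s t, Q.mul (Q.mul r s) t ≠ Q.zero →
    ω s t * ω r (Q.mul s t) = ω r s * ω (Q.mul r s) t) ∧
  (∀ e, Q.IsIdem e → e ≠ Q.zero → ω e e = 1)

end InvSemZ

/-- Basic properties of a normalised `𝕋`-valued `2`-cocycle `ω`
over an inverse semigroup with zero: (1) `ω(s,s*) = ω(s*,s)`; (2) `ω(e,f) = 1` for
idempotents with `e⬝f ≠ 0`; (3) if `0 ≠ s*⬝s ≤ e` then `ω(s,e) = 1 = ω(e,s*)`;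
(4) if `s⬝e ≠ 0` then `ω(s,e) = ω(s⬝e⬝s*, s)`. -/
theorem statement14 (Q : InvSemZ) (ω : Q.T → Q.T → ℂ) (hω : Q.IsCocycle ω) :
    (∀ s : Q.T, s ≠ Q.zero → ω s (Q.star s) = ω (Q.star s) s) ∧
    (∀ e f : Q.T, Q.IsIdem e → Q.IsIdem f → Q.mul e f ≠ Q.zero → ω e f = 1) ∧
    (∀ (s e : Q.T), Q.IsIdem e → Q.mul (Q.star s) s ≠ Q.zero →
      Q.le (Q.mul (Q.star s) s) e → ω s e = 1 ∧ ω e (Q.star s) = 1) ∧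
    (∀ (s e : Q.T), Q.IsIdem e → Q.mul s e ≠ Q.zero →
      ω s e = ω (Q.mul (Q.mul s e) (Q.star s)) s) := by
  obtain ⟨hn, hc, hi⟩ := hω
  have nz : ∀ s t, Q.mul s t ≠ Q.zero → ω s t ≠ 0 := by
    intro s t h h0
    have := hn s t h
    rw [h0] at this
    simp at this
  have hR : ∀ s e, Q.IsIdem e → Q.mul s e = s → s ≠ Q.zero → ω s e = 1 := by
    intro s e he hse hs
    have he' : Q.mul e e = e := he
    have e0 : e ≠ Q.zero := by
      rintro rfl
      exact hs (hse.symm.trans (Q.mul_zero' s))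
    have h := hc s e e (by rw [hse, hse]; exact hs)
    rw [he', hse, hi e he e0, one_mul] at h
    have h1 := nz s e (by rw [hse]; exact hs)
    exact (mul_left_cancel₀ h1 (by rw [mul_one]; exact h)).symm
  have hL : ∀ s e, Q.IsIdem e → Q.mul e s = s → s ≠ Q.zero → ω e s = 1 := by
    intro s e he hes hs
    have he' : Q.mul e e = e := he
    have e0 : e ≠ Q.zero := by
      rintro rfl
      exact hs (hes.symm.trans (Q.zero_mul' s))
    have h := hc e e s (by rw [he', hes]; exact hs)
    rw [he', hes, hi e he e0, one_mul] at h
    have h1 := nz e s (by rw [hes]; exact hs)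
    exact mul_left_cancel₀ h1 (by rw [mul_one]; exact h)
  have idR : ∀ s, Q.IsIdem (Q.mul (Q.star s) s) := by
    intro s
    show Q.mul _ _ = _
    rw [← Q.mul_assoc', Q.gen_inv₂]
  have idL : ∀ s, Q.IsIdem (Q.mul s (Q.star s)) := by
    intro s
    show Q.mul _ _ = _
    rw [← Q.mul_assoc', Q.gen_inv₁]
  refine ⟨?_, ?_, ?_, ?_⟩
  · intro s hs
    have h := hc s (Q.star s) s (by rw [Q.gen_inv₁]; exact hs)
    rw [hR s _ (idR s) (by rw [← Q.mul_assoc', Q.gen_inv₁]) hs,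
      hL s _ (idL s) (Q.gen_inv₁ s) hs, mul_one, mul_one] at h
    exact h.symm
  · intro e f he hf hef
    have he' : Q.mul e e = e := he
    have hf' : Q.mul f f = f := hf
    have hcomm := Q.idem_comm e f he hf
    have h1 : Q.mul e (Q.mul e f) = Q.mul e f := by rw [← Q.mul_assoc', he']
    have h2 : Q.mul f (Q.mul e f) = Q.mul e f := by
      rw [hcomm, ← Q.mul_assoc', hf']
    have h3 : Q.IsIdem (Q.mul e f) := by
      show Q.mul _ _ = _
      rw [Q.mul_assoc', h2, h1]
    have h3' : Q.mul (Q.mul e f) (Q.mul e f) = Q.mul e f := h3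
    have h := hc e f (Q.mul e f) (by rw [h3']; exact hef)
    rw [h2, hL _ f hf h2 hef, hL _ e he h1 hef, hi _ h3 hef, mul_one, mul_one] at h
    exact h.symm
  · intro s e he hp hle
    have he' : Q.mul e e = e := he
    have hle' : Q.mul (Q.star s) s = Q.mul e _ := hle
    have h1 : Q.mul e (Q.mul (Q.star s) s) = Q.mul (Q.star s) s := by
      rw [hle', ← Q.mul_assoc', he']
    have h2 : Q.mul (Q.mul (Q.star s) s) e = Q.mul (Q.star s) s := by
      rw [Q.idem_comm _ e (idR s) he, h1]
    constructor
    · apply hR s e he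
      · calc Q.mul s e = Q.mul (Q.mul (Q.mul s (Q.star s)) s) e := by rw [Q.gen_inv₁]
          _ = Q.mul s (Q.mul (Q.mul (Q.star s) s) e) := by simp only [Q.mul_assoc']
          _ = s := by rw [h2, ← Q.mul_assoc', Q.gen_inv₁]
      · intro h0
        apply hp
        rw [h0, Q.mul_zero']
    · apply hL _ e he
      · calc Q.mul e (Q.star s)
            = Q.mul e (Q.mul (Q.mul (Q.star s) s) (Q.star s)) := by rw [Q.gen_inv₂]
          _ = Q.mul (Q.mul e (Q.mul (Q.star s) s)) (Q.star s) := by simp only [Q.mul_assoc']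
          _ = Q.star s := by rw [h1, Q.gen_inv₂]
      · intro h0
        apply hp
        rw [h0, Q.zero_mul']
  · intro s e he hse
    have he' : Q.mul e e = e := he
    have hee : Q.mul (Q.mul s e) e = Q.mul s e := by rw [Q.mul_assoc', he']
    have hgs : Q.mul (Q.mul (Q.mul s e) (Q.star s)) s = Q.mul s e := by
      calc _ = Q.mul s (Q.mul e (Q.mul (Q.star s) s)) := by simp only [Q.mul_assoc']
        _ = Q.mul (Q.mul (Q.mul s (Q.star s)) s) e := by
          rw [Q.idem_comm e _ he (idR s)]
          simp only [Q.mul_assoc']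
        _ = _ := by rw [Q.gen_inv₁]
    have hgse : Q.mul (Q.mul (Q.mul s e) (Q.star s)) (Q.mul s e) = Q.mul s e := by
      rw [← Q.mul_assoc', hgs, hee]
    have hg : Q.IsIdem (Q.mul (Q.mul s e) (Q.star s)) := by
      show Q.mul _ _ = _
      rw [← Q.mul_assoc', hgse]
    have h := hc (Q.mul (Q.mul s e) (Q.star s)) s e (by rw [hgs, hee]; exact hse)
    rw [hgs, hL _ _ hg hgse hse, hR _ e he hee hse, mul_one, mul_one] at h
    exact h
end
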